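/- For all d ≥ 1, with the standard labelings, if Y_{P_d} ≡_d Σ_{(τ)} c_{(τ)} e_{(τ)}, then Y_{C_{d+1}} ≡_{d+1} Σ_{(τ)} c_{(τ)} e_{(τ+(d+1))}, where C_{d+1} is the cycle on d+1 vertices. Consequently Y_{C_d} is (e)-positive for all d ≥ 1, and X_{C_d} is e-positive. -/

import Mathlib

open Finset

attribute [local instance] Classical.propDecidable

/-- Homogeneous degree-`d` noncommutative symmetric functions, viewed as
coefficient functions on words of length `d` in the variables. -/
abbrev NCF (d : ℕ) := (Fin d → ℕ) → ℚ

/-- A coloring is proper for the edge family `ends` if the endpoints of every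
edge receive distinct colors. -/
def Proper {d : ℕ} {ε : Type*} {C : Type*} (ends : ε → Sym2 (Fin d)) (w : Fin d → C) : Prop :=
  ∀ (e : ε) (i j : Fin d), ends e = s(i, j) → w i ≠ w j

/-- The noncommutative chromatic symmetric function `Y_G`. -/
noncomputable def Y {d : ℕ} {ε : Type*} (ends : ε → Sym2 (Fin d)) : NCF d :=
  fun w => if Proper ends w then 1 else 0

/-- Noncommutative monomial symmetric function indexed by a set partition. -/
noncomputable def mFun {d : ℕ} (π : Setoid (Fin d)) : NCF d :=
  fun w => if (∀ i j, w i = w j ↔ π i j) then 1 else 0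

/-- Noncommutative power sum symmetric function indexed by a set partition. -/
noncomputable def pFun {d : ℕ} (π : Setoid (Fin d)) : NCF d :=
  fun w => if (∀ i j, π i j → w i = w j) then 1 else 0

/-- Noncommutative elementary symmetric function indexed by a set partition. -/
noncomputable def eFun {d : ℕ} (π : Setoid (Fin d)) : NCF d :=
  fun w => if (∀ i j, i ≠ j → π i j → w i ≠ w j) then 1 else 0

noncomputable instance setoidFintype (d : ℕ) : Fintype (Setoid (Fin d)) :=
  Fintype.ofInjective (fun s : Setoid (Fin d) => (s : Fin d → Fin d → Prop))
    (fun s t h => Setoid.ext fun a b => by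
      have := congrFun (congrFun h a) b; simpa using this.to_iff)

/-- Position action of a permutation on words/NCFs. -/
noncomputable def act {d : ℕ} (δ : Equiv.Perm (Fin d)) (f : NCF d) : NCF d :=
  fun w => f (w ∘ δ)

/-- The induction operator `↑`, repeating the last variable. -/
noncomputable def up {n : ℕ} (f : NCF (n + 1)) : NCF (n + 2) :=
  fun w => if w (Fin.last (n + 1)) = w ⟨n, by omega⟩ then f (fun i => w i.castSucc) else 0

/-- Vertex map collapsing the last vertex onto the next-to-last one (for contraction). -/
def collapse {n : ℕ} : Fin (n + 2) → Fin (n + 1) :=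
  fun i => if h : (i : ℕ) < n + 1 then ⟨i, h⟩ else ⟨n, by omega⟩

/-- The partition of `[d]` into connected components of the spanning subgraph with edge set `S`. -/
def components {d : ℕ} {ε : Type*} (ends : ε → Sym2 (Fin d)) (S : Finset ε) :
    Setoid (Fin d) :=
  Relation.EqvGen.setoid (fun i j => ∃ e ∈ S, ends e = s(i, j))

/-- The size of the block of `π` containing `i`. -/
noncomputable def blockCard {n : ℕ} (π : Setoid (Fin n)) (i : Fin n) : ℕ :=
  (Finset.univ.filter (fun j => π i j)).card

/-- The multiset of block sizes (the type `λ(π)`) of a set partition. -/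
noncomputable def sizes {n : ℕ} (π : Setoid (Fin n)) : Multiset ℕ :=
  (Finset.univ.image (fun i => Finset.univ.filter (fun j => π i j))).val.map Finset.card

/-- `σ ≡ᵢ τ` : same type and blocks containing `i` of equal size. -/
def cls {n : ℕ} (i : Fin n) (σ τ : Setoid (Fin n)) : Prop :=
  sizes σ = sizes τ ∧ blockCard σ i = blockCard τ i

/-- Congruence modulo `i` of noncommutative symmetric functions: the amalgamated
coefficients of their `e`-expansions agree on every `≡ᵢ`-class. -/
noncomputable def EquivI {n : ℕ} (i : Fin n) (F G : NCF n) : Prop :=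
  ∃ a b : Setoid (Fin n) → ℚ,
    F = ∑ τ : Setoid (Fin n), a τ • eFun τ ∧
    G = ∑ τ : Setoid (Fin n), b τ • eFun τ ∧
    ∀ τ, (∑ σ : Setoid (Fin n), if cls i σ τ then a σ else 0)
        = ∑ σ : Setoid (Fin n), if cls i σ τ then b σ else 0

/-- `(e)`-positivity with respect to the congruence modulo `i`. -/
noncomputable def EPos {n : ℕ} (i : Fin n) (F : NCF n) : Prop :=
  ∃ a : Setoid (Fin n) → ℚ,
    F = ∑ τ : Setoid (Fin n), a τ • eFun τ ∧
    ∀ τ, 0 ≤ ∑ σ : Setoid (Fin n), if cls i σ τ then a σ else 0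

/-- `(e)`-positivity of a labeled graph: for some labeling and some congruence. -/
noncomputable def EPosG {d : ℕ} {ε : Type*} (ends : ε → Sym2 (Fin d)) : Prop :=
  ∃ (δ : Equiv.Perm (Fin d)) (i : Fin d),
    EPos i (Y (fun e => (ends e).map δ))

/-- Extend a partition of `{0,…,n}` to one of `{0,…,n+m}`: old blocks are kept,
the new elements (indices `≥ n+1`) satisfying `Q` are merged into the block of
the old last element `n`, and the remaining new elements form singletons. -/
def extendB {n : ℕ} (m : ℕ) (π : Setoid (Fin (n + 1))) (Q : ℕ → Prop) :
    Setoid (Fin (n + 1 + m)) where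
  r x y := x = y ∨
    (∃ (hx : (x : ℕ) < n + 1) (hy : (y : ℕ) < n + 1), π ⟨x, hx⟩ ⟨y, hy⟩) ∨
    (((∃ hx : (x : ℕ) < n + 1, π ⟨x, hx⟩ (Fin.last n)) ∨ (n + 1 ≤ (x : ℕ) ∧ Q (x : ℕ))) ∧
     ((∃ hy : (y : ℕ) < n + 1, π ⟨y, hy⟩ (Fin.last n)) ∨ (n + 1 ≤ (y : ℕ) ∧ Q (y : ℕ))))
  iseqv := by
    constructor
    · intro x; exact Or.inl rfl
    · rintro x y (rfl | ⟨hx, hy, h⟩ | ⟨h1, h2⟩)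
      · exact Or.inl rfl
      · exact Or.inr (Or.inl ⟨hy, hx, π.symm h⟩)
      · exact Or.inr (Or.inr ⟨h2, h1⟩)
    · rintro x y z (rfl | ⟨hx, hy, h⟩ | ⟨h1, h2⟩) h'
      · exact h'
      · rcases h' with rfl | ⟨hy', hz, h''⟩ | ⟨h1', h2'⟩
        · exact Or.inr (Or.inl ⟨hx, hy, h⟩)
        · exact Or.inr (Or.inl ⟨hx, hz, π.trans h h''⟩)
        · rcases h1' with ⟨hy', hB⟩ | ⟨hge, _⟩
          · exact Or.inr (Or.inr ⟨Or.inl ⟨hx, π.trans h hB⟩, h2'⟩)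
          · omega
      · rcases h' with rfl | ⟨hy', hz, h''⟩ | ⟨h1', h2'⟩
        · exact Or.inr (Or.inr ⟨h1, h2⟩)
        · rcases h2 with ⟨hy2, hB⟩ | ⟨hge, _⟩
          · exact Or.inr (Or.inr ⟨h1, Or.inl ⟨hz, π.trans (π.trans (π.symm h'') hB) (π.refl _)⟩⟩)
          · omega
        · exact Or.inr (Or.inr ⟨h1, h2'⟩)

/-- `π + (n+1)` : insert the new element `n+1` into the block containing `n`. -/
def addLast {n : ℕ} (π : Setoid (Fin (n + 1))) : Setoid (Fin (n + 2)) :=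
  extendB 1 π (fun _ => True)

/-- `π / (n+1)` : add the new element `n+1` as a singleton block. -/
def addSingleton {n : ℕ} (π : Setoid (Fin (n + 1))) : Setoid (Fin (n + 2)) :=
  extendB 1 π (fun _ => False)

/-- `σ / (d+1),…,(d+m)` : add the new elements as one additional block. -/
def addBlock {d : ℕ} (m : ℕ) (σ : Setoid (Fin d)) : Setoid (Fin (d + m)) where
  r x y := (∃ (hx : (x : ℕ) < d) (hy : (y : ℕ) < d), σ ⟨x, hx⟩ ⟨y, hy⟩) ∨
    (d ≤ (x : ℕ) ∧ d ≤ (y : ℕ))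
  iseqv := by
    constructor
    · intro x
      by_cases h : (x : ℕ) < d
      · exact Or.inl ⟨h, h, σ.refl _⟩
      · exact Or.inr ⟨by omega, by omega⟩
    · rintro x y (⟨hx, hy, h⟩ | ⟨hx, hy⟩)
      · exact Or.inl ⟨hy, hx, σ.symm h⟩
      · exact Or.inr ⟨hy, hx⟩
    · rintro x y z (⟨hx, hy, h⟩ | ⟨hx, hy⟩) (⟨hy', hz, h'⟩ | ⟨hy', hz⟩)
      · exact Or.inl ⟨hx, hz, σ.trans h h'⟩
      · omega
      · omega
      · exact Or.inr ⟨hx, hz⟩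

noncomputable instance setoidLFO (d : ℕ) : LocallyFiniteOrder (Setoid (Fin d)) :=
  Fintype.toLocallyFiniteOrder

/-- The Möbius function of the lattice of set partitions, with values in `ℚ`. -/
noncomputable def muS {d : ℕ} (a b : Setoid (Fin d)) : ℚ :=
  IncidenceAlgebra.mu ℚ a b

/-- Falling factorial `⟨m⟩_i = m(m-1)⋯(m-i+1)` as a rational number. -/
def ffact (m i : ℕ) : ℚ := ∏ j ∈ Finset.range i, ((m : ℚ) - j)

/-- Rising factorial `(b)_i = b(b+1)⋯(b+i-1)` as a rational number. -/
def rfact (b i : ℕ) : ℚ := ∏ j ∈ Finset.range i, ((b : ℚ) + j)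

/-- The path `P_{n+1}` with edges `v_i v_{i+1}`. -/
def pathEnds (n : ℕ) : Fin n → Sym2 (Fin (n + 1)) :=
  fun e => s(e.castSucc, e.succ)

/-- The cycle `C_{n+1}` with edges `v_i v_{i+1}` (indices mod `n+1`). -/
def cycleEnds (n : ℕ) : Fin (n + 1) → Sym2 (Fin (n + 1)) :=
  fun i => s(i, i + 1)

/-- The commutative chromatic symmetric function `X_G` in `N` variables. -/
noncomputable def Xcomm {d : ℕ} {ε : Type*} (ends : ε → Sym2 (Fin d)) (N : ℕ) :
    MvPolynomial (Fin N) ℚ :=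
  ∑ κ : Fin d → Fin N, if Proper ends κ then ∏ i, MvPolynomial.X (κ i) else 0

section Orientations

variable {V : Type*} {ε : Type*}

/-- `o` is an orientation of the graph with edge endpoints `ends`. -/
def IsOrient (ends : ε → Sym2 V) (o : ε → V × V) : Prop :=
  ∀ e, s((o e).1, (o e).2) = ends e

/-- An orientation is acyclic when it admits no directed cycle. -/
def Acyclic (o : ε → V × V) : Prop :=
  ∀ v : V, ¬ Relation.TransGen (fun a b => ∃ e, o e = (a, b)) v v

/-- `v` is a sink: every edge incident to `v` is directed toward `v`. -/
def IsSink (o : ε → V × V) (v : V) : Prop := ∀ e, (o e).1 ≠ v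

/-- The set of acyclic orientations with unique sink `v₀`. -/
def Aset (ends : ε → Sym2 V) (v₀ : V) : Set (ε → V × V) :=
  {o | IsOrient ends o ∧ Acyclic o ∧ IsSink o v₀ ∧ ∀ v, IsSink o v → v = v₀}

end Orientations

/-- A circuit: a closed walk `u_0, u_1, …, u_m, u_0` with distinct vertices and
distinct edges. -/
structure Circuit {d : ℕ} {ε : Type*} (ends : ε → Sym2 (Fin d)) where
  m : ℕ
  v : Fin (m + 1) → Fin d
  f : Fin (m + 1) → ε
  hv : Function.Injective v
  hf : Function.Injective f
  he : ∀ k, ends (f k) = s(v k, v (k + 1))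

/-- The broken circuit obtained from a circuit: its edge set with the largest
edge removed. -/
noncomputable def broken {d : ℕ} {ε : Type*} [LinearOrder ε] {ends : ε → Sym2 (Fin d)}
    (C : Circuit ends) : Finset ε :=
  (Finset.univ.image C.f).erase
    ((Finset.univ.image C.f).max'
      ⟨C.f 0, Finset.mem_image_of_mem _ (Finset.mem_univ _)⟩)

/-- `P(α)`: partitions `τ ≤ π+(d+1)` whose blocks can be listed as `B_1,…,B_l`
with `|B_i| = α_i` and `d+1 ∈ B_1`. -/
def Pset {d : ℕ} (π : Setoid (Fin (d + 1))) (l : ℕ) (α : Fin l → ℕ) :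
    Set (Setoid (Fin (d + 2))) :=
  {τ | τ ≤ addLast π ∧ ∃ B : Fin l → Finset (Fin (d + 2)),
    (∀ x y, τ x y ↔ ∃ i, x ∈ B i ∧ y ∈ B i) ∧
    (∀ i j, i ≠ j → Disjoint (B i) (B j)) ∧
    (∀ i, (B i).card = α i) ∧
    ∃ hl : 0 < l, Fin.last (d + 1) ∈ B ⟨0, hl⟩}

/-- `G + K_{m+1}` : attach a complete graph on `{v_{d}, v_{d+1}, …, v_{d+m}}`
(`m` new vertices) to the last vertex of a graph `G` on `d+1` vertices. -/
def attachEnds {d : ℕ} {ε : Type*} (ends : ε → Sym2 (Fin (d + 1))) (m : ℕ) :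
    ε ⊕ {p : Fin (m + 1) × Fin (m + 1) // p.1 < p.2} → Sym2 (Fin (d + 1 + m))
  | Sum.inl e => (ends e).map (fun x : Fin (d + 1) => (⟨(x : ℕ), by omega⟩ : Fin (d + 1 + m)))
  | Sum.inr p => s(⟨d + (p.1.1 : ℕ), by omega⟩, ⟨d + (p.1.2 : ℕ), by omega⟩)

/-- The disjoint union `G ⊎ K_m`, with the clique on the `m` new vertices. -/
def disjEnds {d : ℕ} {ε : Type*} (ends : ε → Sym2 (Fin d)) (m : ℕ) :
    ε ⊕ {p : Fin m × Fin m // p.1 < p.2} → Sym2 (Fin (d + m))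
  | Sum.inl e => (ends e).map (Fin.castAdd m)
  | Sum.inr p => s(Fin.natAdd d p.1.1, Fin.natAdd d p.1.2)

noncomputable def eProd {N : ℕ} (p : Multiset ℕ) : MvPolynomial (Fin N) ℚ :=
  (p.map (fun k => MvPolynomial.esymm (Fin N) ℚ k)).prod


section Expansions

variable {n : ℕ}

/-- The indicator of the words whose letters in positions `i` and `j` agree. -/
noncomputable def eqInd (i j : Fin n) : NCF n := fun w => if w i = w j then 1 else 0

/-- The partition `π` with `x` split off as a singleton block. -/
def isolate (π : Setoid (Fin n)) (x : Fin n) : Setoid (Fin n) :=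
  π ⊓ Setoid.ker (fun a => a = x)

theorem isolate_iff {π : Setoid (Fin n)} {x a b : Fin n} :
    isolate π x a b ↔ π a b ∧ (a = x ↔ b = x) := by
  refine Setoid.inf_iff_and.trans (and_congr_right fun _ => ?_)
  rw [Setoid.ker_def, eq_iff_iff]

theorem eFun_eq_isolate_mul (π : Setoid (Fin n)) (x : Fin n) :
    eFun π = eFun (isolate π x) -
      ∑ j ∈ univ.filter (fun j => π x j ∧ j ≠ x), eFun (isolate π x) * eqInd x j := by
  funext w
  simp only [Pi.sub_apply, Finset.sum_apply, Pi.mul_apply, ← Finset.mul_sum]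
  by_cases h' : ∀ i j, i ≠ j → isolate π x i j → w i ≠ w j
  · have e' : eFun (isolate π x) w = 1 := if_pos h'
    by_cases h : ∀ i j, i ≠ j → π i j → w i ≠ w j
    · have e : eFun π w = 1 := if_pos h
      rw [e, e', Finset.sum_eq_zero, mul_zero, sub_zero]
      intro j hj
      simp only [mem_filter, mem_univ, true_and] at hj
      exact if_neg (h x j hj.2.symm hj.1)
    · have e : eFun π w = 0 := if_neg h
      have hex : ∃ j, (π x j ∧ j ≠ x) ∧ w x = w j := by
        push Not at h
        obtain ⟨i, j, hij, hπ, hw⟩ := h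
        by_cases hi : i = x
        · subst hi; exact ⟨j, ⟨hπ, hij.symm⟩, hw⟩
        by_cases hj : j = x
        · subst hj; exact ⟨i, ⟨π.symm hπ, hij⟩, hw.symm⟩
        · exact absurd hw (h' i j hij (isolate_iff.2 ⟨hπ, by simp [hi, hj]⟩))
      obtain ⟨j, hj, hw⟩ := hex
      rw [e, e', Finset.sum_eq_single j]
      · simp [eqInd, hw]
      · intro k hk hkj
        simp only [mem_filter, mem_univ, true_and] at hk
        refine if_neg fun hk' => h' k j hkj (isolate_iff.2 ⟨?_, by simp [hk.2, hj.2]⟩) ?_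
        · exact π.trans (π.symm hk.1) hj.1
        · rw [← hk', hw]
      · intro hj'
        simp [hj.1, hj.2] at hj'
  · have e' : eFun (isolate π x) w = 0 := if_neg h'
    have e : eFun π w = 0 := if_neg fun h => h' fun i j hij hr => h i j hij (isolate_iff.1 hr).1
    rw [e, e', zero_mul, sub_zero]

theorem pFun_mul_eqInd {τ : Setoid (Fin n)} {x : Fin n} (hx : ∀ y, τ x y → y = x) (j : Fin n) :
    pFun τ * eqInd x j = pFun (τ.comap (Function.update id x j)) := by
  funext w
  simp only [pFun, eqInd, Pi.mul_apply, Setoid.comap_rel, ← ite_and, mul_ite, mul_one, mul_zero]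
  refine if_congr ⟨?_, ?_⟩ rfl rfl
  · rintro ⟨h1, h2⟩ a b hab
    have key : ∀ a, w (Function.update id x j a) = w a := by
      intro a
      by_cases ha : a = x
      · subst ha; simp [h1]
      · simp [ha]
    rw [← key a, ← key b]
    exact h2 _ _ hab
  · intro h
    have hxj : w x = w j := by
      refine h x j ?_
      by_cases hj : j = x
      · subst hj; exact τ.refl _
      · simp only [Function.update_self, Function.update_of_ne hj, id]; exact τ.refl _
    refine ⟨hxj, fun a b hab => ?_⟩
    by_cases ha : a = x
    · subst ha; rw [hx b hab]
    by_cases hb : b = x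
    · subst hb; rw [hx a (τ.symm hab)]
    refine h a b ?_
    simpa [Function.update_of_ne ha, Function.update_of_ne hb] using hab

theorem comap_isolate {π : Setoid (Fin n)} {x j : Fin n} (hj : π x j) (hjx : j ≠ x) :
    (isolate π x).comap (Function.update id x j) = π := by
  ext a b
  rw [Setoid.comap_rel, isolate_iff]
  have key : ∀ a, Function.update id x j a ≠ x ∧ π a (Function.update id x j a) := by
    intro a
    by_cases ha : a = x
    · subst ha; simp [hjx, hj]
    · simp [ha]
  simp only [(key a).1, (key b).1, iff_self, and_true]
  exact ⟨fun h => π.trans (key a).2 (π.trans h (π.symm (key b).2)),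
    fun h => π.trans (π.symm (key a).2) (π.trans h (key b).2)⟩

theorem comap_lt_of_lt_isolate {π τ : Setoid (Fin n)} {x j : Fin n} (hj : π x j) (hjx : j ≠ x)
    (hτ : τ < isolate π x) : τ.comap (Function.update id x j) < π := by
  refine lt_of_le_not_ge ?_ fun hle => hτ.not_ge fun a b hab => ?_
  · conv_rhs => rw [← comap_isolate hj hjx]
    exact fun a b h => hτ.le h
  · by_cases ha : a = x
    · subst ha
      rw [(isolate_iff.1 hab).2.1 rfl]
    by_cases hb : b = x
    · subst hb
      exact absurd ((isolate_iff.1 hab).2.2 rfl) ha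
    have := hle (isolate_iff.1 hab).1
    rwa [Setoid.comap_rel, Function.update_of_ne ha, Function.update_of_ne hb] at this

/-- The change of basis from power sums to elementary functions is triangular with nonzero
diagonal. -/
theorem exists_eFun_sub_smul_pFun_mem (π : Setoid (Fin n)) :
    ∃ c : ℚ, c ≠ 0 ∧ eFun π - c • pFun π ∈ Submodule.span ℚ (pFun '' {τ | τ < π}) := by
  induction π using WellFoundedLT.induction with
  | ind π ih =>
  by_cases hπ : ∀ x j, π x j → j = x
  · refine ⟨1, one_ne_zero, ?_⟩
    have : eFun π - (1 : ℚ) • pFun π = 0 := by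
      rw [one_smul, sub_eq_zero]
      funext w
      rw [eFun, pFun, if_pos, if_pos]
      · intro i j h; rw [hπ i j h]
      · intro i j hij h; exact absurd (hπ i j h).symm hij
    rw [this]
    exact zero_mem _
  push Not at hπ
  obtain ⟨x, j₀, hj₀, hne⟩ := hπ
  have hlt : isolate π x < π := by
    refine lt_of_le_not_ge inf_le_left fun h => hne ?_
    exact (isolate_iff.1 (h hj₀)).2.1 rfl
  obtain ⟨c, hc, hr⟩ := ih _ hlt
  set B := univ.filter (fun j => π x j ∧ j ≠ x) with hB
  have hBne : (B.card : ℚ) ≠ 0 := by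
    rw [Nat.cast_ne_zero, Finset.card_ne_zero]
    exact ⟨j₀, by simp [hB, hj₀, hne]⟩
  have hiso : ∀ τ, τ ≤ isolate π x → ∀ y, τ x y → y = x := fun τ hτ y hy =>
    (isolate_iff.1 (hτ hy)).2.1 rfl
  set r := eFun (isolate π x) - c • pFun (isolate π x) with hrdef
  have hre : eFun (isolate π x) = c • pFun (isolate π x) + r := by rw [hrdef]; abel
  have hmul : ∀ j ∈ B, eFun (isolate π x) * eqInd x j = c • pFun π + r * eqInd x j := by
    intro j hj
    simp only [hB, mem_filter, mem_univ, true_and] at hj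
    rw [hre, add_mul, smul_mul_assoc, pFun_mul_eqInd (hiso _ le_rfl), comap_isolate hj.1 hj.2]
  have hrj : ∀ j ∈ B, r * eqInd x j ∈ Submodule.span ℚ (pFun '' {τ | τ < π}) := by
    intro j hj
    simp only [hB, mem_filter, mem_univ, true_and] at hj
    have : r ∈ (Submodule.span ℚ (pFun '' {τ | τ < π})).comap
        (LinearMap.mulRight ℚ (eqInd x j)) := by
      refine Submodule.span_le.2 ?_ hr
      rintro _ ⟨τ, hτ, rfl⟩
      rw [SetLike.mem_coe, Submodule.mem_comap, LinearMap.mulRight_apply,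
        pFun_mul_eqInd (hiso _ (le_of_lt hτ))]
      exact Submodule.subset_span ⟨_, comap_lt_of_lt_isolate hj.1 hj.2 hτ, rfl⟩
    exact this
  refine ⟨-(B.card * c), neg_ne_zero.2 (mul_ne_zero hBne hc), ?_⟩
  have key : eFun π - (-(B.card * c)) • pFun π =
      c • pFun (isolate π x) + r - ∑ j ∈ B, r * eqInd x j := by
    rw [eFun_eq_isolate_mul π x, Finset.sum_congr rfl hmul, Finset.sum_add_distrib,
      Finset.sum_const, ← Nat.cast_smul_eq_nsmul ℚ, smul_smul, hre]
    module
  rw [key]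
  refine sub_mem (add_mem (Submodule.smul_mem _ _ (Submodule.subset_span ⟨_, hlt, rfl⟩)) ?_)
    (sum_mem hrj)
  refine Submodule.span_mono (Set.image_mono ?_) hr
  exact fun τ hτ => lt_trans hτ hlt

theorem pFun_mem_span_eFun (π : Setoid (Fin n)) :
    pFun π ∈ Submodule.span ℚ (Set.range (eFun (d := n))) := by
  induction π using WellFoundedLT.induction with
  | ind π ih =>
  obtain ⟨c, hc, hr⟩ := exists_eFun_sub_smul_pFun_mem π
  have hr' : eFun π - c • pFun π ∈ Submodule.span ℚ (Set.range (eFun (d := n))) := by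
    refine Submodule.span_le.2 ?_ hr
    rintro _ ⟨τ, hτ, rfl⟩
    exact ih τ hτ
  have : pFun π = c⁻¹ • (eFun π - (eFun π - c • pFun π)) := by
    rw [sub_sub_cancel, smul_smul, inv_mul_cancel₀ hc, one_smul]
  rw [this]
  exact Submodule.smul_mem _ _ (sub_mem (Submodule.subset_span ⟨π, rfl⟩) hr')

theorem mFun_apply (π : Setoid (Fin n)) (w : Fin n → ℕ) :
    mFun π w = if π = Setoid.ker w then 1 else 0 := by
  refine if_congr ⟨fun h => Setoid.ext fun i j => (h i j).symm, ?_⟩ rfl rfl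
  rintro rfl i j
  rfl

theorem mFun_mem_span_eFun (π : Setoid (Fin n)) :
    mFun π ∈ Submodule.span ℚ (Set.range (eFun (d := n))) := by
  induction π using WellFoundedGT.induction with
  | ind π ih =>
  have : mFun π = pFun π - ∑ σ ∈ univ.filter (fun σ => π < σ), mFun σ := by
    funext w
    simp only [Pi.sub_apply, Finset.sum_apply, mFun_apply, Finset.sum_ite_eq', mem_filter,
      mem_univ, true_and]
    have hp : pFun π w = if π ≤ Setoid.ker w then 1 else 0 :=
      if_congr ⟨fun h i j => h i j, fun h i j hij => h hij⟩ rfl rfl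
    rw [hp]
    by_cases h : π = Setoid.ker w
    · simp [← h]
    · by_cases hle : π ≤ Setoid.ker w
      · simp [h, hle, lt_of_le_of_ne hle h]
      · have hlt : ¬ π < Setoid.ker w := fun hlt => hle hlt.le
        simp [h, hle, hlt]
  rw [this]
  exact sub_mem (pFun_mem_span_eFun π) (sum_mem fun σ hσ => ih σ (by simpa using hσ))

/-- A symmetric function: its coefficient at a word depends only on the coincidences among the
letters. -/
def IsSymm (f : NCF n) : Prop :=
  ∀ w w' : Fin n → ℕ, Setoid.ker w = Setoid.ker w' → f w = f w'

/-- A word whose coincidences are prescribed by `π`. -/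
noncomputable def wordOf (π : Setoid (Fin n)) : Fin n → ℕ :=
  fun i => ((Quotient.mk π i).out : Fin n)

theorem ker_wordOf (π : Setoid (Fin n)) : Setoid.ker (wordOf π) = π := by
  ext i j
  rw [Setoid.ker_def]
  simp only [wordOf, Fin.val_inj, Quotient.out_inj]
  exact Quotient.eq

theorem IsSymm.mem_span {f : NCF n} (hf : IsSymm f) :
    f ∈ Submodule.span ℚ (Set.range (eFun (d := n))) := by
  have : f = ∑ π, f (wordOf π) • mFun π := by
    funext w
    simp only [Finset.sum_apply, Pi.smul_apply, mFun_apply, smul_eq_mul, mul_ite, mul_one,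
      mul_zero, Finset.sum_ite_eq', mem_univ, if_true]
    exact hf _ _ (ker_wordOf _).symm
  rw [this]
  exact sum_mem fun π _ => Submodule.smul_mem _ _ (mFun_mem_span_eFun π)

theorem exists_eq_sum_eFun {f : NCF n} (hf : f ∈ Submodule.span ℚ (Set.range (eFun (d := n)))) :
    ∃ a : Setoid (Fin n) → ℚ, f = ∑ τ, a τ • eFun τ := by
  obtain ⟨a, ha⟩ := (Submodule.mem_span_range_iff_exists_fun ℚ).1 hf
  exact ⟨a, ha.symm⟩

theorem linearIndependent_eFun : LinearIndependent ℚ (eFun (d := n)) := by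
  rw [linearIndependent_iff_injective_fintypeLinearCombination]
  set ev : NCF n →ₗ[ℚ] (Setoid (Fin n) → ℚ) := LinearMap.funLeft ℚ ℚ wordOf
  have hs : Function.Surjective (ev ∘ₗ Fintype.linearCombination ℚ (eFun (d := n))) := by
    intro g
    have hsym : IsSymm (fun w : Fin n → ℕ => g (Setoid.ker w)) := fun w w' h => congrArg g h
    obtain ⟨a, ha⟩ := exists_eq_sum_eFun hsym.mem_span
    refine ⟨a, ?_⟩
    funext π
    simp only [LinearMap.comp_apply, Fintype.linearCombination_apply, ← ha, ev,
      LinearMap.funLeft_apply, ker_wordOf]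
  have hi := LinearMap.injective_iff_surjective.2 hs
  rw [LinearMap.coe_comp] at hi
  exact hi.of_comp

theorem isSymm_eFun (π : Setoid (Fin n)) : IsSymm (eFun π) := by
  intro w w' h
  have h' : ∀ i j, w i = w j ↔ w' i = w' j := fun i j => Setoid.ext_iff.1 h i j
  simp only [eFun, ne_eq, h']

end Expansions

section Classes

variable {n : ℕ}

/-- The sum of `f (|B_i|)` over all `i`, where `B_i` is the block of `π` containing `i`. -/
noncomputable def blockSum (f : ℕ → ℚ) (π : Setoid (Fin n)) : ℚ := ∑ i, f (blockCard π i)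

theorem blockCard_pos (π : Setoid (Fin n)) (i : Fin n) : 0 < blockCard π i :=
  Finset.card_pos.2 ⟨i, by simp⟩

theorem filter_rel_eq_iff {π : Setoid (Fin n)} {i j : Fin n} :
    univ.filter (fun k => π i k) = univ.filter (fun k => π j k) ↔ π i j := by
  constructor
  · intro h
    have : j ∈ univ.filter (fun k => π i k) := h ▸ by simp
    simpa using this
  · intro h
    ext k
    simpa using ⟨fun h' => π.trans (π.symm h) h', fun h' => π.trans h h'⟩

theorem card_fiber_block (π : Setoid (Fin n)) (i : Fin n) :
    (univ.filter (fun j => univ.filter (fun k => π j k) = univ.filter (fun k => π i k))).card =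
      blockCard π i := by
  simp only [filter_rel_eq_iff, blockCard]
  congr 1
  ext j
  simpa using ⟨π.symm, π.symm⟩

theorem sum_map_sizes (h : ℕ → ℚ) (π : Setoid (Fin n)) :
    ((sizes π).map h).sum = blockSum (fun k => h k / k) π := by
  have h1 : ((sizes π).map h).sum =
      ∑ B ∈ univ.image (fun i => univ.filter (fun j => π i j)), h B.card := by
    rw [sizes, Multiset.map_map]
    rfl
  have h2 : blockSum (fun k => h k / k) π =
      ∑ i, (fun B : Finset (Fin n) => h B.card / B.card) (univ.filter (fun j => π i j)) := rfl
  rw [h1, h2, Finset.sum_comp (fun B : Finset (Fin n) => h B.card / B.card)]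
  refine Finset.sum_congr rfl fun B hB => ?_
  obtain ⟨i, -, rfl⟩ := Finset.mem_image.1 hB
  rw [card_fiber_block, nsmul_eq_mul]
  exact (mul_div_cancel₀ _ (Nat.cast_ne_zero.2 (blockCard_pos π i).ne')).symm

theorem sizes_eq_iff {σ τ : Setoid (Fin n)} :
    sizes σ = sizes τ ↔ ∀ f : ℕ → ℚ, blockSum f σ = blockSum f τ := by
  constructor
  · intro h f
    have key : ∀ π : Setoid (Fin n),
        blockSum f π = ((sizes π).map (fun k => k * f k)).sum := by
      intro π
      rw [sum_map_sizes]
      refine Finset.sum_congr rfl fun i _ => ?_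
      exact (mul_div_cancel_left₀ _ (Nat.cast_ne_zero.2 (blockCard_pos π i).ne')).symm
    rw [key, key, h]
  · intro h
    have key : ∀ (k : ℕ) (s : Multiset ℕ),
        (s.map (fun j => if j = k then (1 : ℚ) else 0)).sum = s.count k := by
      intro k s
      induction s using Multiset.induction with
      | empty => simp
      | cons a s ih =>
        rw [Multiset.map_cons, Multiset.sum_cons, ih, Multiset.count_cons]
        simp only [eq_comm (a := a)]
        push_cast
        ring
    refine Multiset.ext.2 fun k => ?_
    have := key k (sizes σ)
    rw [sum_map_sizes, h, ← sum_map_sizes, key] at this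
    exact_mod_cast this.symm

theorem cls_iff {i : Fin n} {σ τ : Setoid (Fin n)} :
    cls i σ τ ↔ (∀ f : ℕ → ℚ, blockSum f σ = blockSum f τ) ∧ blockCard σ i = blockCard τ i :=
  and_congr_left fun _ => sizes_eq_iff

theorem cls_comap (δ : Equiv.Perm (Fin n)) {i : Fin n} (hi : δ i = i) (π : Setoid (Fin n)) :
    cls i (π.comap δ) π := by
  have key : ∀ j, blockCard (π.comap δ) j = blockCard π (δ j) := by
    intro j
    refine Finset.card_equiv δ fun k => ?_
    simp [Setoid.comap_rel]
  refine cls_iff.2 ⟨fun f => ?_, by rw [key, hi]⟩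
  simp only [blockSum, key]
  exact Equiv.sum_comp δ fun j => f (blockCard π j)

/-- The span of the differences of elementary functions that are congruent modulo `i`. -/
def congrSpan (i : Fin n) : Submodule ℚ (NCF n) :=
  Submodule.span ℚ {f | ∃ σ τ, cls i σ τ ∧ f = eFun σ - eFun τ}

theorem eFun_sub_eFun_mem {i : Fin n} {σ τ : Setoid (Fin n)} (h : cls i σ τ) :
    eFun σ - eFun τ ∈ congrSpan i :=
  Submodule.subset_span ⟨σ, τ, h, rfl⟩

theorem map_mem_congrSpan {m : ℕ} {i : Fin n} {j : Fin m} (L : NCF n →ₗ[ℚ] NCF m)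
    (hL : ∀ σ τ, cls i σ τ → L (eFun σ) - L (eFun τ) ∈ congrSpan j) {f : NCF n}
    (hf : f ∈ congrSpan i) : L f ∈ congrSpan j := by
  have : f ∈ (congrSpan j).comap L := by
    refine Submodule.span_le.2 ?_ hf
    rintro _ ⟨σ, τ, h, rfl⟩
    rw [SetLike.mem_coe, Submodule.mem_comap, map_sub]
    exact hL σ τ h
  exact this

/-- The sum of the coefficients over the class of `τ` modulo `i`. -/
noncomputable def classSum (i : Fin n) (τ : Setoid (Fin n)) : (Setoid (Fin n) → ℚ) →ₗ[ℚ] ℚ :=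
  ∑ σ ∈ univ.filter (fun σ => cls i σ τ), LinearMap.proj σ

theorem classSum_apply (i : Fin n) (τ : Setoid (Fin n)) (k : Setoid (Fin n) → ℚ) :
    classSum i τ k = ∑ σ, if cls i σ τ then k σ else 0 := by
  rw [← Finset.sum_filter, classSum, LinearMap.sum_apply]
  rfl

theorem sum_eFun_mem_congrSpan {i : Fin n} {k : Setoid (Fin n) → ℚ}
    (hk : ∀ τ, classSum i τ k = 0) : ∑ σ, k σ • eFun σ ∈ congrSpan i := by
  set S : Setoid (Setoid (Fin n)) := Setoid.ker fun σ => (sizes σ, blockCard σ i)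
  have hS : ∀ σ τ, S σ τ ↔ cls i σ τ := fun σ τ => Prod.mk_inj
  have hout : ∀ σ (q : Quotient S), Quotient.mk S σ = q ↔ cls i σ q.out := by
    intro σ q
    rw [← hS, ← Quotient.eq (r := S), Quotient.out_eq]
  have h1 : ∑ σ, k σ • eFun σ =
      ∑ σ, k σ • (eFun σ - eFun (Quotient.mk S σ).out) + ∑ σ, k σ • eFun (Quotient.mk S σ).out := by
    rw [← Finset.sum_add_distrib]
    refine Finset.sum_congr rfl fun σ _ => ?_
    rw [← smul_add, sub_add_cancel]
  have h2 : ∑ σ, k σ • eFun (Quotient.mk S σ).out = 0 := by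
    rw [← Finset.sum_fiberwise univ (Quotient.mk S)]
    refine Finset.sum_eq_zero fun q _ => ?_
    have : ∀ σ ∈ univ.filter (fun σ => Quotient.mk S σ = q),
        k σ • eFun (Quotient.mk S σ).out = k σ • eFun q.out := by
      intro σ hσ
      rw [(Finset.mem_filter.1 hσ).2]
    rw [Finset.sum_congr rfl this, ← Finset.sum_smul, Finset.sum_filter]
    simp only [hout, ← classSum_apply, hk, zero_smul]
  rw [h1, h2, add_zero]
  exact sum_mem fun σ _ => Submodule.smul_mem _ _ (eFun_sub_eFun_mem ((hout σ _).1 rfl))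

theorem exists_of_mem_congrSpan {i : Fin n} {f : NCF n} (hf : f ∈ congrSpan i) :
    ∃ k : Setoid (Fin n) → ℚ, f = ∑ σ, k σ • eFun σ ∧ ∀ τ, classSum i τ k = 0 := by
  induction hf using Submodule.span_induction with
  | mem f hf =>
    obtain ⟨σ, τ, h, rfl⟩ := hf
    refine ⟨Pi.single σ 1 - Pi.single τ 1, ?_, fun ρ => ?_⟩
    · simp [sub_smul, Pi.single_apply, Finset.sum_sub_distrib, ite_smul]
    · have hρ : cls i σ ρ ↔ cls i τ ρ := by simp only [cls, h.1, h.2]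
      have hs : ∀ π : Setoid (Fin n),
          classSum i ρ (Pi.single π 1) = if cls i π ρ then 1 else 0 := by
        intro π
        rw [classSum_apply, Finset.sum_eq_single π (fun υ _ h => by simp [h]) (by simp),
          Pi.single_eq_same]
      rw [map_sub, hs, hs, if_congr hρ rfl rfl, sub_self]
  | zero => exact ⟨0, by simp, by simp⟩
  | add f g _ _ hf hg =>
    obtain ⟨a, rfl, ha⟩ := hf
    obtain ⟨b, rfl, hb⟩ := hg
    exact ⟨a + b, by simp [add_smul, Finset.sum_add_distrib], fun ρ => by
      rw [map_add, ha, hb, add_zero]⟩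
  | smul c f _ hf =>
    obtain ⟨a, rfl, ha⟩ := hf
    exact ⟨c • a, by simp [Finset.smul_sum, smul_smul], fun ρ => by rw [map_smul, ha, smul_zero]⟩

theorem equivI_iff {i : Fin n} {F G : NCF n} :
    EquivI i F G ↔ F ∈ Submodule.span ℚ (Set.range (eFun (d := n))) ∧ F - G ∈ congrSpan i := by
  simp only [EquivI, ← classSum_apply]
  constructor
  · rintro ⟨a, b, rfl, rfl, h⟩
    refine ⟨sum_mem fun τ _ => Submodule.smul_mem _ _ (Submodule.subset_span ⟨τ, rfl⟩), ?_⟩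
    rw [← Finset.sum_sub_distrib]
    simp only [← sub_smul]
    refine sum_eFun_mem_congrSpan (k := a - b) fun τ => ?_
    rw [map_sub, h, sub_self]
  · rintro ⟨hF, hFG⟩
    obtain ⟨a, ha⟩ := exists_eq_sum_eFun hF
    obtain ⟨k, hk, hk0⟩ := exists_of_mem_congrSpan hFG
    refine ⟨a, a - k, ha, ?_, fun τ => by rw [map_sub, hk0, sub_zero]⟩
    simp only [Pi.sub_apply, sub_smul, Finset.sum_sub_distrib, ← ha, ← hk]
    abel

/-- `F` is congruent modulo `i` to a nonnegative combination of elementary functions. -/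
def CongrNonneg (i : Fin n) (F : NCF n) : Prop :=
  ∃ a : Setoid (Fin n) → ℚ, (∀ τ, 0 ≤ a τ) ∧ F - ∑ τ, a τ • eFun τ ∈ congrSpan i

theorem CongrNonneg.ePos {i : Fin n} {F : NCF n} (h : CongrNonneg i F) : EPos i F := by
  obtain ⟨a, ha, hF⟩ := h
  obtain ⟨k, hk, hk0⟩ := exists_of_mem_congrSpan hF
  refine ⟨a + k, ?_, fun τ => ?_⟩
  · simp only [Pi.add_apply, add_smul, Finset.sum_add_distrib, ← hk]
    abel
  · rw [← classSum_apply, map_add, hk0, add_zero, classSum_apply]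
    refine Finset.sum_nonneg fun σ _ => ?_
    split_ifs
    exacts [ha σ, le_rfl]

theorem CongrNonneg.of_sub_mem {i : Fin n} {F G : NCF n} (hG : CongrNonneg i G)
    (h : F - G ∈ congrSpan i) : CongrNonneg i F := by
  obtain ⟨a, ha, hG⟩ := hG
  exact ⟨a, ha, by simpa using add_mem h hG⟩

theorem congrNonneg_zero (i : Fin n) : CongrNonneg i 0 := ⟨0, fun _ => le_rfl, by simp⟩

theorem congrNonneg_eFun (i : Fin n) (τ : Setoid (Fin n)) : CongrNonneg i (eFun τ) := by
  refine ⟨Pi.single τ 1, fun σ => ?_, ?_⟩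
  · rw [Pi.single_apply]
    split_ifs <;> norm_num
  · simp [Pi.single_apply, ite_smul]

theorem CongrNonneg.add {i : Fin n} {F G : NCF n} (hF : CongrNonneg i F) (hG : CongrNonneg i G) :
    CongrNonneg i (F + G) := by
  obtain ⟨a, ha, hF⟩ := hF
  obtain ⟨b, hb, hG⟩ := hG
  refine ⟨a + b, fun τ => add_nonneg (ha τ) (hb τ), ?_⟩
  simpa [add_smul, Finset.sum_add_distrib, add_sub_add_comm] using add_mem hF hG

theorem CongrNonneg.smul {i : Fin n} {F : NCF n} (hF : CongrNonneg i F) {c : ℚ} (hc : 0 ≤ c) :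
    CongrNonneg i (c • F) := by
  obtain ⟨a, ha, hF⟩ := hF
  refine ⟨c • a, fun τ => mul_nonneg hc (ha τ), ?_⟩
  simpa [smul_sub, Finset.smul_sum, smul_smul] using Submodule.smul_mem _ c hF

theorem CongrNonneg.map {m : ℕ} {i : Fin n} {j : Fin m} (L : NCF n →ₗ[ℚ] NCF m)
    (hL : ∀ σ τ, cls i σ τ → L (eFun σ) - L (eFun τ) ∈ congrSpan j)
    (hL' : ∀ τ, CongrNonneg j (L (eFun τ))) {F : NCF n} (hF : CongrNonneg i F) :
    CongrNonneg j (L F) := by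
  obtain ⟨a, ha, hF⟩ := hF
  refine CongrNonneg.of_sub_mem (G := L (∑ τ, a τ • eFun τ)) ?_ (by
    rw [← map_sub]; exact map_mem_congrSpan L hL hF)
  rw [map_sum]
  refine Finset.sum_induction _ (CongrNonneg j) (fun _ _ => CongrNonneg.add)
    (congrNonneg_zero j) fun τ _ => ?_
  rw [map_smul]
  exact (hL' τ).smul (ha τ)

end Classes

section Insertion

variable {n : ℕ}

/-- The position action as a linear map. -/
noncomputable def actLin (δ : Equiv.Perm (Fin n)) : NCF n →ₗ[ℚ] NCF n :=
  LinearMap.funLeft ℚ ℚ fun w => w ∘ δ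

/-- Restriction of words to all positions but the last, as a linear map on functions. -/
noncomputable def extLin : NCF n →ₗ[ℚ] NCF (n + 1) :=
  LinearMap.funLeft ℚ ℚ fun w i => w i.castSucc

/-- The induction operator as a linear map. -/
noncomputable def upLin : NCF (n + 1) →ₗ[ℚ] NCF (n + 2) :=
  LinearMap.mulRight ℚ (eqInd (Fin.last (n + 1)) (Fin.last n).castSucc) ∘ₗ extLin

theorem actLin_apply (δ : Equiv.Perm (Fin n)) (f : NCF n) (w : Fin n → ℕ) :
    actLin δ f w = f (w ∘ δ) := rfl

theorem extLin_apply (f : NCF n) (w : Fin (n + 1) → ℕ) :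
    extLin f w = f (fun i => w i.castSucc) := rfl

theorem upLin_apply (f : NCF (n + 1)) (w : Fin (n + 2) → ℕ) :
    upLin f w = f (fun i => w i.castSucc) *
      if w (Fin.last (n + 1)) = w (Fin.last n).castSucc then 1 else 0 := rfl

theorem actLin_eFun (δ : Equiv.Perm (Fin n)) (π : Setoid (Fin n)) :
    actLin δ (eFun π) = eFun (π.comap δ.symm) := by
  funext w
  refine if_congr ⟨fun h i j hij hπ => ?_, fun h i j hij hπ => ?_⟩ rfl rfl
  · simpa using h (δ.symm i) (δ.symm j) (by simpa using hij) hπ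
  · exact h (δ i) (δ j) (by simpa using hij) (by simpa [Setoid.comap_rel] using hπ)

theorem actLin_sub_mem {δ : Equiv.Perm (Fin n)} {i : Fin n} (hi : δ i = i) {f : NCF n}
    (hf : f ∈ Submodule.span ℚ (Set.range (eFun (d := n)))) :
    actLin δ f - f ∈ congrSpan i := by
  have : f ∈ (congrSpan i).comap (actLin δ - LinearMap.id) := by
    refine Submodule.span_le.2 ?_ hf
    rintro _ ⟨π, rfl⟩
    rw [SetLike.mem_coe, Submodule.mem_comap, LinearMap.sub_apply, LinearMap.id_apply, actLin_eFun]
    exact eFun_sub_eFun_mem (cls_comap _ (by rw [Equiv.symm_apply_eq, hi]) _)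
  exact this

theorem addLast_castSucc {π : Setoid (Fin (n + 1))} {i j : Fin (n + 1)} :
    addLast π i.castSucc j.castSucc ↔ π i j := by
  constructor
  · rintro (h | ⟨_, _, h⟩ | ⟨⟨_, h⟩ | ⟨h, _⟩, ⟨_, h'⟩ | ⟨h', _⟩⟩)
    · rw [Fin.castSucc_injective _ h]
    · exact h
    · exact π.trans h (π.symm h')
    all_goals simp only [Fin.val_castSucc] at h h'; omega
  · exact fun h => Or.inr (Or.inl ⟨i.2, j.2, h⟩)

theorem addLast_last {π : Setoid (Fin (n + 1))} {j : Fin (n + 1)} :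
    addLast π (Fin.last (n + 1)) j.castSucc ↔ π j (Fin.last n) := by
  constructor
  · rintro (h | ⟨h, _, _⟩ | ⟨_, ⟨_, h'⟩ | ⟨h', _⟩⟩)
    · exact absurd h.symm (Fin.castSucc_ne_last j)
    · simp at h
    · exact h'
    · simp only [Fin.val_castSucc] at h'; omega
  · exact fun h => Or.inr (Or.inr ⟨Or.inr ⟨le_rfl, trivial⟩, Or.inl ⟨j.2, h⟩⟩)

theorem addSingleton_castSucc {π : Setoid (Fin (n + 1))} {i j : Fin (n + 1)} :
    addSingleton π i.castSucc j.castSucc ↔ π i j := by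
  constructor
  · rintro (h | ⟨_, _, h⟩ | ⟨⟨_, h⟩ | ⟨_, h⟩, ⟨_, h'⟩ | ⟨_, h'⟩⟩)
    · rw [Fin.castSucc_injective _ h]
    · exact h
    · exact π.trans h (π.symm h')
    all_goals contradiction
  · exact fun h => Or.inr (Or.inl ⟨i.2, j.2, h⟩)

theorem not_addSingleton_last {π : Setoid (Fin (n + 1))} {j : Fin (n + 1)} :
    ¬ addSingleton π (Fin.last (n + 1)) j.castSucc := by
  rintro (h | ⟨h, _, _⟩ | ⟨⟨h, _⟩ | ⟨_, h⟩, _⟩)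
  · exact absurd h.symm (Fin.castSucc_ne_last j)
  · simp at h
  · simp at h
  · exact h

theorem isolate_addLast (π : Setoid (Fin (n + 1))) :
    isolate (addLast π) (Fin.last (n + 1)) = addSingleton π := by
  ext a b
  rw [isolate_iff]
  induction a using Fin.lastCases with
  | last =>
    induction b using Fin.lastCases with
    | last => simp
    | cast b => simp [not_addSingleton_last]
  | cast a =>
    induction b using Fin.lastCases with
    | last => simpa using fun h => not_addSingleton_last ((addSingleton π).symm h)
    | cast b => simp [addLast_castSucc, addSingleton_castSucc]

theorem blockCard_eq_sum (π : Setoid (Fin n)) (i : Fin n) :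
    blockCard π i = ∑ j, if π i j then 1 else 0 := by
  rw [blockCard, Finset.card_filter]

theorem blockCard_addLast_castSucc (π : Setoid (Fin (n + 1))) (i : Fin (n + 1)) :
    blockCard (addLast π) i.castSucc =
      if π i (Fin.last n) then blockCard π (Fin.last n) + 1 else blockCard π i := by
  have hl : addLast π i.castSucc (Fin.last (n + 1)) ↔ π i (Fin.last n) :=
    ⟨fun h => addLast_last.1 ((addLast π).symm h), fun h => (addLast π).symm (addLast_last.2 h)⟩
  rw [blockCard_eq_sum, Fin.sum_univ_castSucc]
  simp only [addLast_castSucc, hl, ← blockCard_eq_sum]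
  split_ifs with h
  · rw [blockCard, blockCard, filter_rel_eq_iff.2 h]
  · rw [add_zero]

theorem blockCard_addLast_last (π : Setoid (Fin (n + 1))) :
    blockCard (addLast π) (Fin.last (n + 1)) = blockCard π (Fin.last n) + 1 := by
  have h : addLast π (Fin.last (n + 1)) (Fin.last n).castSucc := addLast_last.2 (π.refl _)
  have := blockCard_addLast_castSucc π (Fin.last n)
  rw [if_pos (π.refl _)] at this
  rw [← this, blockCard, blockCard, filter_rel_eq_iff.2 h]

theorem blockCard_addSingleton_castSucc (π : Setoid (Fin (n + 1))) (i : Fin (n + 1)) :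
    blockCard (addSingleton π) i.castSucc = blockCard π i := by
  have hl : ¬ addSingleton π i.castSucc (Fin.last (n + 1)) :=
    fun h => not_addSingleton_last ((addSingleton π).symm h)
  rw [blockCard_eq_sum, Fin.sum_univ_castSucc, if_neg hl, add_zero]
  simp only [addSingleton_castSucc, ← blockCard_eq_sum]

theorem blockCard_addSingleton_last (π : Setoid (Fin (n + 1))) :
    blockCard (addSingleton π) (Fin.last (n + 1)) = 1 := by
  rw [blockCard_eq_sum, Fin.sum_univ_castSucc, if_pos ((addSingleton π).refl _)]
  simp [not_addSingleton_last]

theorem blockSum_addLast (f : ℕ → ℚ) (π : Setoid (Fin (n + 1))) :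
    blockSum f (addLast π) = blockSum f π +
      blockCard π (Fin.last n) *
        (f (blockCard π (Fin.last n) + 1) - f (blockCard π (Fin.last n))) +
      f (blockCard π (Fin.last n) + 1) := by
  have h : ∀ i : Fin (n + 1), f (blockCard (addLast π) i.castSucc) = f (blockCard π i) +
      (if π (Fin.last n) i then 1 else 0) *
        (f (blockCard π (Fin.last n) + 1) - f (blockCard π (Fin.last n))) := by
    intro i
    rw [blockCard_addLast_castSucc]
    by_cases hi : π i (Fin.last n)
    · have : blockCard π i = blockCard π (Fin.last n) := by
        rw [blockCard, blockCard, filter_rel_eq_iff.2 hi]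
      rw [if_pos hi, if_pos (π.symm hi), this]
      ring
    · rw [if_neg hi, if_neg fun h => hi (π.symm h)]
      ring
  rw [blockSum, Fin.sum_univ_castSucc, blockCard_addLast_last, blockCard_eq_sum π (Fin.last n)]
  simp only [h, Finset.sum_add_distrib, ← Finset.sum_mul, blockSum, ← blockCard_eq_sum]
  rw [blockCard_eq_sum π (Fin.last n)]
  push_cast
  rfl

theorem blockSum_addSingleton (f : ℕ → ℚ) (π : Setoid (Fin (n + 1))) :
    blockSum f (addSingleton π) = blockSum f π + f 1 := by
  rw [blockSum, Fin.sum_univ_castSucc, blockCard_addSingleton_last]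
  simp only [blockCard_addSingleton_castSucc, blockSum]

theorem cls_addLast {σ τ : Setoid (Fin (n + 1))} (h : cls (Fin.last n) σ τ) :
    cls (Fin.last (n + 1)) (addLast σ) (addLast τ) := by
  rw [cls_iff] at h ⊢
  exact ⟨fun f => by rw [blockSum_addLast, blockSum_addLast, h.1, h.2],
    by rw [blockCard_addLast_last, blockCard_addLast_last, h.2]⟩

theorem cls_addSingleton {σ τ : Setoid (Fin (n + 1))} (h : cls (Fin.last n) σ τ) :
    cls (Fin.last (n + 1)) (addSingleton σ) (addSingleton τ) := by
  rw [cls_iff] at h ⊢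
  exact ⟨fun f => by rw [blockSum_addSingleton, blockSum_addSingleton, h.1],
    by rw [blockCard_addSingleton_last, blockCard_addSingleton_last]⟩

theorem extLin_eFun (π : Setoid (Fin (n + 1))) : extLin (eFun π) = eFun (addSingleton π) := by
  funext w
  refine if_congr ⟨fun h i j hij hπ => ?_, fun h i j hij hπ => ?_⟩ rfl rfl
  · induction i using Fin.lastCases with
    | last =>
      induction j using Fin.lastCases with
      | last => exact absurd rfl hij
      | cast j => exact absurd hπ not_addSingleton_last
    | cast i =>
      induction j using Fin.lastCases with
      | last => exact absurd ((addSingleton π).symm hπ) not_addSingleton_last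
      | cast j => exact h i j (fun h => hij (h ▸ rfl)) (addSingleton_castSucc.1 hπ)
  · exact h _ _ (fun h => hij (Fin.castSucc_injective _ h)) (addSingleton_castSucc.2 hπ)

theorem IsSymm.upLin {f : NCF (n + 1)} (hf : IsSymm f) : IsSymm (upLin f) := by
  intro w w' h
  have h' : ∀ i j, w i = w j ↔ w' i = w' j := fun i j => Setoid.ext_iff.1 h i j
  rw [upLin_apply, upLin_apply, hf _ (fun i => w' i.castSucc), if_congr (h' _ _) rfl rfl]
  exact Setoid.ext fun i j => h' _ _

theorem comap_swap {π : Setoid (Fin n)} {a b : Fin n} (h : π a b) :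
    π.comap (Equiv.swap a b) = π := by
  have key : ∀ c, π c (Equiv.swap a b c) := by
    intro c
    by_cases ha : c = a
    · subst ha; simpa using h
    by_cases hb : c = b
    · subst hb; simpa using π.symm h
    rw [Equiv.swap_apply_of_ne_of_ne ha hb]
  ext c d
  rw [Setoid.comap_rel]
  exact ⟨fun h => π.trans (key c) (π.trans h (π.symm (key d))),
    fun h => π.trans (π.symm (key c)) (π.trans h (key d))⟩

theorem actLin_upLin_eFun {π : Setoid (Fin (n + 1))} {j : Fin (n + 1)} (hj : π j (Fin.last n)) :
    actLin (Equiv.swap j.castSucc (Fin.last n).castSucc) (upLin (eFun π)) =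
      eFun (addSingleton π) * eqInd (Fin.last (n + 1)) j.castSucc := by
  have h1 : upLin (eFun π) =
      eFun (addSingleton π) * eqInd (Fin.last (n + 1)) (Fin.last n).castSucc := by
    rw [← extLin_eFun]
    rfl
  have h2 := actLin_eFun (Equiv.swap j.castSucc (Fin.last n).castSucc) (addSingleton π)
  rw [Equiv.symm_swap, comap_swap (addSingleton_castSucc.2 hj)] at h2
  conv_rhs => rw [← h2]
  rw [h1]
  funext w
  simp only [actLin_apply, Pi.mul_apply, eqInd, Function.comp_apply, Equiv.swap_apply_right]
  rw [Equiv.swap_apply_of_ne_of_ne (Fin.castSucc_ne_last _).symm (Fin.castSucc_ne_last _).symm]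

/-- Inducing an elementary function, modulo the last position. -/
theorem upLin_eFun_congr (π : Setoid (Fin (n + 1))) :
    (blockCard π (Fin.last n) : ℚ) • upLin (eFun π) -
      (eFun (addSingleton π) - eFun (addLast π)) ∈ congrSpan (Fin.last (n + 1)) := by
  set B := univ.filter (fun j => addLast π (Fin.last (n + 1)) j ∧ j ≠ Fin.last (n + 1)) with hB
  have hBimg : B = (univ.filter (fun j => π (Fin.last n) j)).map Fin.castSuccEmb := by
    ext j
    induction j using Fin.lastCases with
    | last => simp [hB]
    | cast j =>
      simp only [hB, mem_filter, mem_univ, true_and, addLast_last, mem_map, Fin.coe_castSuccEmb]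
      constructor
      · exact fun h => ⟨j, π.symm h.1, rfl⟩
      · rintro ⟨k, hk, hkj⟩
        obtain rfl := Fin.castSucc_injective _ hkj
        exact ⟨π.symm hk, Fin.castSucc_ne_last _⟩
  have key : (blockCard π (Fin.last n) : ℚ) • upLin (eFun π) -
      (eFun (addSingleton π) - eFun (addLast π)) =
      ∑ j ∈ univ.filter (fun j => π (Fin.last n) j),
        (upLin (eFun π) - eFun (addSingleton π) * eqInd (Fin.last (n + 1)) j.castSucc) := by
    rw [eFun_eq_isolate_mul (addLast π) (Fin.last (n + 1)), isolate_addLast, sub_sub_cancel, ← hB,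
      hBimg, Finset.sum_map, Finset.sum_sub_distrib, Finset.sum_const, Nat.cast_smul_eq_nsmul]
    rfl
  rw [key]
  refine sum_mem fun j hj => ?_
  rw [← actLin_upLin_eFun (π.symm (by simpa using hj)), ← neg_sub]
  refine neg_mem (actLin_sub_mem ?_ (isSymm_eFun π).upLin.mem_span)
  exact Equiv.swap_apply_of_ne_of_ne (Fin.castSucc_ne_last _).symm (Fin.castSucc_ne_last _).symm

theorem extLin_cls {σ τ : Setoid (Fin (n + 1))} (h : cls (Fin.last n) σ τ) :
    extLin (eFun σ) - extLin (eFun τ) ∈ congrSpan (Fin.last (n + 1)) := by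
  rw [extLin_eFun, extLin_eFun]
  exact eFun_sub_eFun_mem (cls_addSingleton h)

theorem upLin_cls {σ τ : Setoid (Fin (n + 1))} (h : cls (Fin.last n) σ τ) :
    upLin (eFun σ) - upLin (eFun τ) ∈ congrSpan (Fin.last (n + 1)) := by
  have hb : (blockCard τ (Fin.last n) : ℚ) ≠ 0 := Nat.cast_ne_zero.2 (blockCard_pos _ _).ne'
  have hσ := upLin_eFun_congr σ
  rw [h.2] at hσ
  rw [← Submodule.smul_mem_iff _ hb]
  have := add_mem (sub_mem hσ (upLin_eFun_congr τ)) (sub_mem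
    (eFun_sub_eFun_mem (cls_addSingleton h)) (eFun_sub_eFun_mem (cls_addLast h)))
  convert this using 1
  module

theorem exists_linearMap_eFun_addLast :
    ∃ T : NCF (n + 1) →ₗ[ℚ] NCF (n + 2), ∀ τ, T (eFun τ) = eFun (addLast τ) := by
  obtain ⟨g, hg⟩ := LinearMap.exists_leftInverse_of_injective
    (Fintype.linearCombination ℚ (eFun (d := n + 1)))
    (LinearMap.ker_eq_bot.2 linearIndependent_eFun.fintypeLinearCombination_injective)
  refine ⟨Fintype.linearCombination ℚ (fun τ => eFun (addLast τ)) ∘ₗ g, fun τ => ?_⟩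
  have h1 : Fintype.linearCombination ℚ (eFun (d := n + 1)) (Pi.single τ 1) = eFun τ := by
    simp [Fintype.linearCombination_apply_single]
  have h2 := LinearMap.congr_fun hg (Pi.single τ 1)
  rw [LinearMap.comp_apply, h1, LinearMap.id_apply] at h2
  rw [LinearMap.comp_apply, h2]
  simp [Fintype.linearCombination_apply_single]

/-- The linear extension of `e_τ ↦ e_{τ+(n+1)}`. -/
noncomputable def insLin : NCF (n + 1) →ₗ[ℚ] NCF (n + 2) :=
  exists_linearMap_eFun_addLast.choose

theorem insLin_eFun (τ : Setoid (Fin (n + 1))) : insLin (eFun τ) = eFun (addLast τ) :=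
  exists_linearMap_eFun_addLast.choose_spec τ

theorem insLin_cls {σ τ : Setoid (Fin (n + 1))} (h : cls (Fin.last n) σ τ) :
    insLin (eFun σ) - insLin (eFun τ) ∈ congrSpan (Fin.last (n + 1)) := by
  rw [insLin_eFun, insLin_eFun]
  exact eFun_sub_eFun_mem (cls_addLast h)

/-- Appending a vertex joined to the last one, modulo the last position. -/
theorem extLin_sub_upLin_eFun_congr (π : Setoid (Fin (n + 1))) :
    (extLin - upLin : NCF (n + 1) →ₗ[ℚ] NCF (n + 2)) (eFun π) -
      ((1 - (blockCard π (Fin.last n) : ℚ)⁻¹) • eFun (addSingleton π) +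
        (blockCard π (Fin.last n) : ℚ)⁻¹ • eFun (addLast π)) ∈ congrSpan (Fin.last (n + 1)) := by
  have hb : (blockCard π (Fin.last n) : ℚ) ≠ 0 := Nat.cast_ne_zero.2 (blockCard_pos _ _).ne'
  rw [← Submodule.smul_mem_iff _ hb]
  convert neg_mem (upLin_eFun_congr π) using 1
  rw [LinearMap.sub_apply, extLin_eFun]
  match_scalars <;> field_simp
  ring

/-- The defect between appending a path vertex and closing the cycle. -/
theorem extLin_sub_upLin_sub_insLin_eFun_congr (π : Setoid (Fin (n + 1))) :
    (extLin - upLin - insLin : NCF (n + 1) →ₗ[ℚ] NCF (n + 2)) (eFun π) -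
      ((blockCard π (Fin.last n) : ℚ) - 1) • upLin (eFun π) ∈ congrSpan (Fin.last (n + 1)) := by
  convert neg_mem (upLin_eFun_congr π) using 1
  rw [LinearMap.sub_apply, LinearMap.sub_apply, extLin_eFun, insLin_eFun]
  module

end Insertion

section PathsAndCycles

theorem proper_iff {d : ℕ} {ε C : Type*} {ends : ε → Sym2 (Fin d)} {a b : ε → Fin d}
    (h : ∀ e, ends e = s(a e, b e)) {w : Fin d → C} :
    Proper ends w ↔ ∀ e, w (a e) ≠ w (b e) := by
  refine ⟨fun hw e => hw e _ _ (h e), fun hw e i j hij => ?_⟩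
  rw [h e, Sym2.eq_iff] at hij
  rcases hij with ⟨rfl, rfl⟩ | ⟨rfl, rfl⟩
  exacts [hw e, (hw e).symm]

theorem proper_pathEnds {n : ℕ} {C : Type*} {w : Fin (n + 1) → C} :
    Proper (pathEnds n) w ↔ ∀ e : Fin n, w e.castSucc ≠ w e.succ :=
  proper_iff fun _ => rfl

theorem proper_pathEnds_succ {n : ℕ} {C : Type*} {w : Fin (n + 2) → C} :
    Proper (pathEnds (n + 1)) w ↔ Proper (pathEnds n) (fun i => w i.castSucc) ∧
      w (Fin.last (n + 1)) ≠ w (Fin.last n).castSucc := by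
  simp only [proper_pathEnds, Fin.forall_fin_succ', Fin.succ_castSucc, Fin.succ_last]
  exact and_congr_right fun _ => ne_comm

theorem proper_pathEnds_rev {n : ℕ} {C : Type*} {w : Fin (n + 1) → C} :
    Proper (pathEnds n) (fun i => w i.rev) ↔ Proper (pathEnds n) w := by
  simp only [proper_pathEnds, Fin.rev_castSucc, Fin.rev_succ]
  exact ⟨fun h e => by simpa using (h e.rev).symm, fun h e => (h e.rev).symm⟩

theorem proper_cycleEnds {n : ℕ} {C : Type*} {w : Fin (n + 1) → C} :
    Proper (cycleEnds n) w ↔ Proper (pathEnds n) w ∧ w (Fin.last n) ≠ w 0 := by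
  rw [proper_iff (ends := cycleEnds n) (a := fun i => i) (b := fun i => i + 1) fun _ => rfl,
    proper_pathEnds, Fin.forall_fin_succ']
  simp only [Fin.coeSucc_eq_succ, Fin.last_add_one]

/-- Reverse all positions but the last. -/
def revInit (n : ℕ) : Equiv.Perm (Fin (n + 2)) :=
  Function.Involutive.toPerm
    (Fin.lastCases (motive := fun _ => Fin (n + 2)) (Fin.last (n + 1)) fun i => i.rev.castSucc) (by
      intro i
      induction i using Fin.lastCases <;> simp)

theorem revInit_last (n : ℕ) : revInit n (Fin.last (n + 1)) = Fin.last (n + 1) :=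
  Fin.lastCases_last (motive := fun _ => Fin (n + 2)) (cast := fun i => i.rev.castSucc)

theorem revInit_castSucc {n : ℕ} (i : Fin (n + 1)) : revInit n i.castSucc = i.rev.castSucc :=
  Fin.lastCases_castSucc (motive := fun _ => Fin (n + 2)) (cast := fun i => i.rev.castSucc) i

theorem isSymm_Y {n : ℕ} {ε : Type*} (ends : ε → Sym2 (Fin n)) : IsSymm (Y ends) := by
  intro w w' h
  have h' : ∀ i j, w i = w j ↔ w' i = w' j := fun i j => Setoid.ext_iff.1 h i j
  refine if_congr ?_ rfl rfl
  simp only [Proper, ne_eq, h']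

theorem Y_pathEnds_zero : Y (pathEnds 0) = eFun ⊤ := by
  funext w
  rw [Y, eFun, if_pos (proper_pathEnds.2 fun e => e.elim0),
    if_pos fun i j hij => absurd (Fin.ext (by omega)) hij]

theorem Y_pathEnds_succ (n : ℕ) :
    Y (pathEnds (n + 1)) =
      (extLin - upLin : NCF (n + 1) →ₗ[ℚ] NCF (n + 2)) (Y (pathEnds n)) := by
  funext w
  rw [LinearMap.sub_apply, Pi.sub_apply, extLin_apply, upLin_apply]
  simp only [Y, proper_pathEnds_succ, ite_and]
  split_ifs <;> simp_all

/-- Deletion and contraction of the edge between the last two vertices of a cycle. -/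
theorem Y_cycleEnds_succ (n : ℕ) :
    Y (cycleEnds (n + 1)) =
      actLin (revInit n) (Y (pathEnds (n + 1))) - upLin (Y (cycleEnds n)) := by
  funext w
  have hact : Proper (pathEnds (n + 1)) (w ∘ revInit n) ↔
      Proper (pathEnds n) (fun i => w i.castSucc) ∧ w (Fin.last (n + 1)) ≠ w 0 := by
    rw [proper_pathEnds_succ]
    simp only [Function.comp_apply, revInit_last, revInit_castSucc, Fin.rev_last]
    rw [proper_pathEnds_rev (w := fun i => w i.castSucc)]
    rfl
  rw [Pi.sub_apply, actLin_apply, upLin_apply]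
  simp only [Y, hact, proper_cycleEnds, proper_pathEnds_succ, Fin.castSucc_zero]
  by_cases hp : Proper (pathEnds n) (fun i => w i.castSucc)
  · by_cases hu : w (Fin.last (n + 1)) = w (Fin.last n).castSucc
    · simp [hp, hu]
    · simp [hp, hu]
  · simp [hp]

theorem Y_cycleEnds_zero : Y (cycleEnds 0) = 0 := by
  funext w
  refine if_neg fun h => ?_
  rw [proper_cycleEnds] at h
  exact h.2 rfl

theorem mem_span_of_map {n m : ℕ} {i : Fin m} (L : NCF n →ₗ[ℚ] NCF m)
    (hL : ∀ τ, L (eFun τ) ∈ congrSpan i) {f : NCF n}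
    (hf : f ∈ Submodule.span ℚ (Set.range (eFun (d := n)))) : L f ∈ congrSpan i := by
  have : f ∈ (congrSpan i).comap L := by
    refine Submodule.span_le.2 ?_ hf
    rintro _ ⟨π, rfl⟩
    exact hL π
  exact this

theorem sub_cls {n m : ℕ} {i : Fin n} {j : Fin m} {L M : NCF n →ₗ[ℚ] NCF m}
    (hL : ∀ σ τ, cls i σ τ → L (eFun σ) - L (eFun τ) ∈ congrSpan j)
    (hM : ∀ σ τ, cls i σ τ → M (eFun σ) - M (eFun τ) ∈ congrSpan j) (σ τ : Setoid (Fin n))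
    (h : cls i σ τ) : (L - M) (eFun σ) - (L - M) (eFun τ) ∈ congrSpan j := by
  convert sub_mem (hL σ τ h) (hM σ τ h) using 1
  simp only [LinearMap.sub_apply]
  abel

/-- Two successive additions of a path vertex against closing up the cycle. -/
theorem defect_mem_congrSpan {n : ℕ} {f : NCF (n + 1)}
    (hf : f ∈ Submodule.span ℚ (Set.range (eFun (d := n + 1)))) :
    ((extLin - upLin - insLin : NCF (n + 2) →ₗ[ℚ] NCF (n + 3)) ∘ₗ (extLin - upLin) -
      upLin ∘ₗ insLin : NCF (n + 1) →ₗ[ℚ] NCF (n + 3)) f ∈ congrSpan (Fin.last (n + 2)) := by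
  refine mem_span_of_map _ (fun τ => ?_) hf
  have h1 := map_mem_congrSpan (extLin - upLin - insLin : NCF (n + 2) →ₗ[ℚ] NCF (n + 3))
    (sub_cls (sub_cls (fun _ _ => extLin_cls) fun _ _ => upLin_cls) fun _ _ => insLin_cls)
    (extLin_sub_upLin_eFun_congr τ)
  have h2 := extLin_sub_upLin_sub_insLin_eFun_congr (addSingleton τ)
  have h3 := extLin_sub_upLin_sub_insLin_eFun_congr (addLast τ)
  rw [blockCard_addSingleton_last] at h2
  rw [blockCard_addLast_last] at h3
  set b := blockCard τ (Fin.last n)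
  have hb : (b : ℚ) ≠ 0 := Nat.cast_ne_zero.2 (blockCard_pos _ _).ne'
  have := add_mem (add_mem h1 (Submodule.smul_mem _ (1 - (b : ℚ)⁻¹) h2))
    (Submodule.smul_mem _ (b : ℚ)⁻¹ h3)
  convert this using 1
  rw [LinearMap.sub_apply, LinearMap.comp_apply, LinearMap.comp_apply, insLin_eFun]
  simp only [map_sub (extLin - upLin - insLin : NCF (n + 2) →ₗ[ℚ] NCF (n + 3)), map_add, map_smul]
  push_cast
  match_scalars <;> field_simp <;> ring

theorem Y_cycleEnds_congr (n : ℕ) :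
    Y (cycleEnds (n + 1)) - insLin (Y (pathEnds n)) ∈ congrSpan (Fin.last (n + 1)) := by
  induction n with
  | zero =>
    have h1 : Y (cycleEnds 1) = eFun (addLast (⊤ : Setoid (Fin 1))) := by
      have h01 : addLast (⊤ : Setoid (Fin 1)) 1 0 :=
        addLast_last (n := 0) (j := 0).2 trivial
      funext w
      refine if_congr ?_ rfl rfl
      simp only [proper_cycleEnds, proper_pathEnds, Fin.forall_fin_one]
      simp [h01, (addLast (⊤ : Setoid (Fin 1))).symm h01, Fin.last]
    rw [Y_pathEnds_zero, insLin_eFun, h1, sub_self]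
    exact zero_mem _
  | succ n ih =>
    have h1 := actLin_sub_mem (revInit_last (n + 1)) (isSymm_Y (pathEnds (n + 2))).mem_span
    have h2 := map_mem_congrSpan upLin (fun _ _ => upLin_cls) ih
    have h3 := defect_mem_congrSpan (isSymm_Y (pathEnds n)).mem_span
    convert add_mem (sub_mem h1 h2) h3 using 1
    rw [Y_cycleEnds_succ, LinearMap.sub_apply, LinearMap.comp_apply, ← Y_pathEnds_succ,
      LinearMap.sub_apply, ← Y_pathEnds_succ, map_sub, LinearMap.comp_apply]
    abel

theorem congrNonneg_Y_pathEnds (n : ℕ) : CongrNonneg (Fin.last n) (Y (pathEnds n)) := by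
  induction n with
  | zero =>
    rw [Y_pathEnds_zero]
    exact congrNonneg_eFun _ _
  | succ n ih =>
    rw [Y_pathEnds_succ]
    refine ih.map _ (sub_cls (fun _ _ => extLin_cls) fun _ _ => upLin_cls) fun τ => ?_
    have hb : (1 : ℚ) ≤ blockCard τ (Fin.last n) := Nat.one_le_cast.2 (blockCard_pos _ _)
    refine CongrNonneg.of_sub_mem ?_ (extLin_sub_upLin_eFun_congr τ)
    exact ((congrNonneg_eFun _ _).smul (sub_nonneg.2 (inv_le_one_of_one_le₀ hb))).add
      ((congrNonneg_eFun _ _).smul (by positivity))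

theorem congrNonneg_Y_cycleEnds (n : ℕ) : CongrNonneg (Fin.last n) (Y (cycleEnds n)) := by
  cases n with
  | zero =>
    rw [Y_cycleEnds_zero]
    exact congrNonneg_zero _
  | succ n =>
    refine CongrNonneg.of_sub_mem ?_ (Y_cycleEnds_congr n)
    refine (congrNonneg_Y_pathEnds n).map insLin (fun _ _ => insLin_cls) fun τ => ?_
    rw [insLin_eFun]
    exact congrNonneg_eFun _ _

end PathsAndCycles

section CommutativeImage

open MvPolynomial

variable {n : ℕ}

/-- Letting the variables commute, in `N` variables. -/
noncomputable def commLin (N : ℕ) : NCF n →ₗ[ℚ] MvPolynomial (Fin N) ℚ where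
  toFun F := ∑ κ : Fin n → Fin N, F (fun i => (κ i : ℕ)) • ∏ i, X (κ i)
  map_add' F G := by simp only [Pi.add_apply, add_smul, Finset.sum_add_distrib]
  map_smul' c F := by
    simp only [Pi.smul_apply, smul_assoc, Finset.smul_sum, RingHom.id_apply]

theorem commLin_apply (N : ℕ) (F : NCF n) :
    commLin N F = ∑ κ : Fin n → Fin N, F (fun i => (κ i : ℕ)) • ∏ i, X (κ i) := rfl

theorem commLin_Y {ε : Type*} (ends : ε → Sym2 (Fin n)) (N : ℕ) :
    commLin N (Y ends) = Xcomm ends N := by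
  refine Finset.sum_congr rfl fun κ _ => ?_
  have h : Proper ends (fun i => (κ i : ℕ)) ↔ Proper ends κ := by
    simp only [Proper, ne_eq, Fin.val_inj]
  by_cases hp : Proper ends κ
  · rw [Y, if_pos (h.2 hp), if_pos hp, one_smul]
  · rw [Y, if_neg (mt h.1 hp), if_neg hp, zero_smul]

theorem card_injective_image_eq {α β : Type*} [Fintype α] [Fintype β] [DecidableEq α]
    [DecidableEq β] {s : Finset β} (hs : s.card = Fintype.card α) :
    (univ.filter fun g : α → β => Function.Injective g ∧ univ.image g = s).card =
      (Fintype.card α).factorial := by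
  have e : α ≃ s := Fintype.equivOfCardEq (by rw [Fintype.card_coe, hs])
  rw [← Fintype.card_equiv e, ← Finset.card_univ]
  symm
  refine Finset.card_bij (fun f _ i => (f i : β)) (fun f _ => ?_) (fun f _ g _ h => ?_)
    fun g hg => ?_
  · refine Finset.mem_filter.2 ⟨Finset.mem_univ _,
      Subtype.val_injective.comp f.injective, ?_⟩
    ext b
    simp only [Finset.mem_image, Finset.mem_univ, true_and]
    exact ⟨fun ⟨i, hi⟩ => hi ▸ (f i).2, fun hb => ⟨f.symm ⟨b, hb⟩, by simp⟩⟩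
  · exact Equiv.ext fun i => Subtype.ext (congrFun h i)
  · obtain ⟨-, hinj, rfl⟩ := Finset.mem_filter.1 hg
    refine ⟨Equiv.ofBijective (fun i => ⟨g i, Finset.mem_image_of_mem _ (Finset.mem_univ i)⟩)
      ⟨fun i j h => hinj (congrArg Subtype.val h), ?_⟩, Finset.mem_univ _, rfl⟩
    rintro ⟨b, hb⟩
    obtain ⟨i, -, rfl⟩ := Finset.mem_image.1 hb
    exact ⟨i, rfl⟩

theorem sum_injective_prod_X {α : Type*} [Fintype α] [DecidableEq α] (N : ℕ) :
    ∑ g ∈ univ.filter (fun g : α → Fin N => Function.Injective g),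
      ∏ i, (X (g i) : MvPolynomial (Fin N) ℚ) =
      ((Fintype.card α).factorial : ℚ) • esymm (Fin N) ℚ (Fintype.card α) := by
  rw [esymm, Finset.smul_sum,
    ← Finset.sum_fiberwise_of_maps_to (t := powersetCard (Fintype.card α) univ)
    (g := fun g : α → Fin N => univ.image g)]
  · refine Finset.sum_congr rfl fun s hs => ?_
    rw [Finset.filter_filter, ← card_injective_image_eq (Finset.mem_powersetCard.1 hs).2,
      Nat.cast_smul_eq_nsmul, ← Finset.sum_const]
    refine Finset.sum_congr rfl fun g hg => ?_
    obtain ⟨-, hinj, rfl⟩ := Finset.mem_filter.1 hg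
    rw [Finset.prod_image hinj.injOn]
  · intro g hg
    refine Finset.mem_powersetCard.2 ⟨Finset.subset_univ _, ?_⟩
    rw [Finset.card_image_of_injective _ (Finset.mem_filter.1 hg).2, Finset.card_univ]

theorem commLin_eFun (N : ℕ) (τ : Setoid (Fin n)) :
    commLin N (eFun τ) =
      ((sizes τ).map fun k => (k.factorial : ℚ) • esymm (Fin N) ℚ k).prod := by
  set blk : Fin n → Finset (Fin n) := fun i => univ.filter fun j => τ i j with hblk
  have hprod : ((sizes τ).map fun k => (k.factorial : ℚ) • esymm (Fin N) ℚ k).prod =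
      ∏ q : Finset (Fin n), ∑ g ∈ univ.filter
        (fun g : {i // blk i = q} → Fin N => Function.Injective g),
        ∏ i, (X (g i) : MvPolynomial (Fin N) ℚ) := by
    have h1 : ((sizes τ).map fun k => (k.factorial : ℚ) • esymm (Fin N) ℚ k).prod =
        ∏ B ∈ univ.image blk, (B.card.factorial : ℚ) • esymm (Fin N) ℚ B.card := by
      rw [sizes, Multiset.map_map]
      rfl
    simp only [sum_injective_prod_X]
    rw [h1]
    refine Finset.prod_subset_one_on_sdiff (Finset.subset_univ _) (fun q hq => ?_) fun q hq => ?_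
    · have : IsEmpty {i // blk i = q} := ⟨fun i => (Finset.mem_sdiff.1 hq).2
        (Finset.mem_image.2 ⟨i, Finset.mem_univ _, i.2⟩)⟩
      simp
    · obtain ⟨i, -, rfl⟩ := Finset.mem_image.1 hq
      rw [Fintype.card_subtype, card_fiber_block]
      rfl
  rw [hprod, Finset.prod_univ_sum, commLin_apply]
  simp only [eFun, ite_smul, one_smul, zero_smul]
  rw [← Finset.sum_filter]
  refine Finset.sum_equiv (((Equiv.sigmaFiberEquiv blk).arrowCongr (Equiv.refl (Fin N))).symm.trans
    (Equiv.piCurry fun _ _ => Fin N)) (fun κ => ?_) fun κ _ => ?_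
  · simp only [Finset.mem_filter, Finset.mem_univ, true_and, Fintype.mem_piFinset]
    constructor
    · rintro h q ⟨i, rfl⟩ ⟨j, hj⟩ hij
      by_contra hne
      exact h i j (fun h => hne (Subtype.ext h)) (filter_rel_eq_iff.1 hj.symm)
        (congrArg Fin.val hij)
    · intro h i j hne hij heq
      exact hne (congrArg Subtype.val (@h (blk i) ⟨i, rfl⟩ ⟨j, (filter_rel_eq_iff.2 hij).symm⟩
        (Fin.ext heq)))
  · rw [← (Equiv.sigmaFiberEquiv blk).prod_comp, Fintype.prod_sigma]
    rfl

theorem commLin_eq_zero (N : ℕ) {i : Fin n} {f : NCF n} (hf : f ∈ congrSpan i) :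
    commLin N f = 0 := by
  have : f ∈ LinearMap.ker (commLin N) := by
    refine Submodule.span_le.2 ?_ hf
    rintro _ ⟨σ, τ, h, rfl⟩
    rw [SetLike.mem_coe, LinearMap.mem_ker, map_sub, commLin_eFun, commLin_eFun, h.1, sub_self]
  exact this

/-- The block sizes of a set partition, as an integer partition. -/
noncomputable def sizesPartition (τ : Setoid (Fin n)) : Nat.Partition n where
  parts := sizes τ
  parts_pos := by
    intro k hk
    obtain ⟨B, hB, rfl⟩ := Multiset.mem_map.1 hk
    obtain ⟨i, -, rfl⟩ := Finset.mem_image.1 (Finset.mem_def.2 hB)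
    exact blockCard_pos τ i
  parts_sum := by
    have h := sum_map_sizes (fun k => (k : ℚ)) τ
    have h1 : ∀ i, (blockCard τ i : ℚ) / blockCard τ i = 1 := fun i =>
      div_self (Nat.cast_ne_zero.2 (blockCard_pos τ i).ne')
    simp only [blockSum, h1, Finset.sum_const, Finset.card_univ, Fintype.card_fin,
      nsmul_eq_mul, mul_one] at h
    rw [← Nat.cast_multiset_sum] at h
    exact_mod_cast h

theorem commLin_eFun_eq_eProd (N : ℕ) (τ : Setoid (Fin n)) :
    commLin N (eFun τ) =
      ((sizes τ).map fun k => (k.factorial : ℚ)).prod • eProd (sizes τ) := by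
  rw [commLin_eFun, eProd]
  induction sizes τ using Multiset.induction with
  | empty => simp
  | cons a s ih => simp only [Multiset.map_cons, Multiset.prod_cons, ih, smul_mul_smul_comm]

/-- Congruence to a nonnegative combination of elementary functions gives `e`-positivity of the
commutative image, uniformly in the number of variables. -/
theorem CongrNonneg.exists_commLin_eq {i : Fin n} {F : NCF n} (hF : CongrNonneg i F) :
    ∃ c : Nat.Partition n → ℚ, (∀ p, 0 ≤ c p) ∧
      ∀ N : ℕ, commLin N F = ∑ p : Nat.Partition n, c p • eProd p.parts := by
  obtain ⟨a, ha, hF⟩ := hF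
  refine ⟨fun p => ∑ τ ∈ univ.filter fun τ => sizesPartition τ = p,
    a τ * ((sizes τ).map fun k => (k.factorial : ℚ)).prod, fun p => ?_, fun N => ?_⟩
  · refine Finset.sum_nonneg fun τ _ => mul_nonneg (ha τ) (Multiset.prod_nonneg fun x hx => ?_)
    obtain ⟨k, -, rfl⟩ := Multiset.mem_map.1 hx
    exact Nat.cast_nonneg _
  · have h := commLin_eq_zero N hF
    rw [map_sub, sub_eq_zero] at h
    rw [h, map_sum, ← Finset.sum_fiberwise univ sizesPartition]
    refine Finset.sum_congr rfl fun p _ => ?_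
    rw [Finset.sum_smul]
    refine Finset.sum_congr rfl fun τ hτ => ?_
    rw [← (Finset.mem_filter.1 hτ).2, map_smul, commLin_eFun_eq_eProd, smul_smul]
    rfl

end CommutativeImage

/-- The `(e)`-expansion of the cycle is obtained from that of the path by
inserting `d+1` into the block containing `d`; consequently cycles are
`(e)`-positive and `X_{C_d}` is `e`-positive. -/
theorem cycle_from_path_and_ePositive :
    (∀ (d : ℕ) (c : Setoid (Fin (d + 1)) → ℚ),
      EquivI (Fin.last d) (Y (pathEnds d)) (∑ τ : Setoid (Fin (d + 1)), c τ • eFun τ) →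
      EquivI (Fin.last (d + 1)) (Y (cycleEnds (d + 1)))
        (∑ τ : Setoid (Fin (d + 1)), c τ • eFun (addLast τ))) ∧
    (∀ n : ℕ, EPos (Fin.last n) (Y (cycleEnds n))) ∧
    (∀ n : ℕ, ∃ c : Nat.Partition (n + 1) → ℚ, (∀ p, 0 ≤ c p) ∧
      ∀ N : ℕ, Xcomm (cycleEnds n) N =
        ∑ p : Nat.Partition (n + 1), c p • eProd p.parts) := by
  refine ⟨fun d c h => ?_, fun n => (congrNonneg_Y_cycleEnds n).ePos, fun n => ?_⟩
  · have hc := map_mem_congrSpan insLin (fun _ _ => insLin_cls) (equivI_iff.1 h).2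
    refine equivI_iff.2 ⟨(isSymm_Y _).mem_span, ?_⟩
    convert add_mem (Y_cycleEnds_congr d) hc using 1
    simp only [map_sub, map_sum, map_smul, insLin_eFun]
    abel
  · simp only [← commLin_Y]
    exact (congrNonneg_Y_cycleEnds n).exists_commLin_eq
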